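/- Let p be a prime, k ≥ 2 an integer, q = p^k, and let H ∈ BH(n,q) be a Butson Hadamard matrix. Suppose 𝐱 ∈ ℂ^n has all entries q-th roots of unity and is a bent vector for H with root-of-unity dual, i.e., for every row 𝐰 of H the Hermitian inner product ⟨𝐱,𝐰⟩ = Σ_i x_i·conj(w_i) equals √n·ζ for some q-th root of unity ζ. Then the covering radius of the Butson Hadamard code C_H for the homogeneous distance on Z_{p^k} satisfies r(C_H) ≥ (p^{k−1} − p^{k−2})·(n − √n). -/

import Mathlib

open Classical

/-- `ζ_q^x = exp(2πi·x/q)` for `x ∈ ℤ/q`. -/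
noncomputable def zetaPow (q : ℕ) (x : ZMod q) : ℂ :=
  Complex.exp (2 * Real.pi * Complex.I * x.val / q)

/-- The homogeneous weight on `ℤ/p^k` (`p` prime, `k ≥ 2`): `wt(0) = 0`,
`wt(x) = p^{k-1}` for nonzero `x ∈ p^{k-1}·ℤ/p^k`, and `wt(x) = (p-1)p^{k-2}` otherwise. -/
noncomputable def homWeight (p k : ℕ) (x : ZMod (p ^ k)) : ℝ :=
  if x = 0 then 0
  else if x ∈ Set.range (fun y : ZMod (p ^ k) => (p : ZMod (p ^ k)) ^ (k - 1) * y)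
  then (p : ℝ) ^ (k - 1)
  else ((p : ℝ) - 1) * (p : ℝ) ^ (k - 2)

/-- The homogeneous distance on `(ℤ/p^k)^n`. -/
noncomputable def homDist (p k n : ℕ) (u v : Fin n → ZMod (p ^ k)) : ℝ :=
  ∑ i, homWeight p k (u i - v i)

/-- The Butson Hadamard code attached to the logarithmic form `LH` of a Butson
Hadamard matrix: all vectors `L(𝐰) + α·𝟏` with `𝐰` a row of `H` and `α ∈ ℤ/q`. -/
def BHCode (q n : ℕ) (LH : Fin n → Fin n → ZMod q) : Set (Fin n → ZMod q) :=
  {c | ∃ (i : Fin n) (α : ZMod q), c = fun j => LH i j + α}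

/-- The covering radius of a code `C ⊆ (ℤ/p^k)^n` for the homogeneous distance. -/
noncomputable def covRad (p k n : ℕ) (C : Set (Fin n → ZMod (p ^ k))) : ℝ :=
  ⨆ x : Fin n → ZMod (p ^ k), ⨅ c : C, homDist p k n x c

/-- If a sum of `q`-th roots of unity is `√N` times a `q`-th root of unity, then each of its
Galois conjugates has modulus `√N`. -/
theorem norm_sum_pow_eq_sqrt_of_coprime {ι : Type*} {q u N : ℕ} (hq : 0 < q)
    (hu : u.Coprime q) (s : Finset ι) (w : ι → ℂ) (hw : ∀ i, w i ^ q = 1) (ξ : ℂ)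
    (hξ : ξ ^ q = 1) (h : ∑ i ∈ s, w i = Real.sqrt N * ξ) :
    ‖∑ i ∈ s, w i ^ u‖ = Real.sqrt N := by
  have : NeZero q := ⟨hq.ne'⟩
  have hζ := Complex.isPrimitiveRoot_exp q hq.ne'
  set ζ := Complex.exp (2 * Real.pi * Complex.I / q)
  choose a _ ha using fun i => hζ.eq_pow_of_pow_eq_one (hw i)
  obtain ⟨t, -, ht⟩ := hζ.eq_pow_of_pow_eq_one hξ
  have hsq : ((Real.sqrt N : ℝ) : ℂ) ^ 2 = N := by
    exact_mod_cast Real.sq_sqrt (Nat.cast_nonneg N)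
  let P : Polynomial ℤ := (∑ i ∈ s, Polynomial.X ^ a i) ^ 2 - (N : Polynomial ℤ) *
    (Polynomial.X ^ t) ^ 2
  have hP (z : ℂ) : Polynomial.aeval z P = (∑ i ∈ s, z ^ a i) ^ 2 - N * (z ^ t) ^ 2 := by
    simp [P]
  have hP0 : Polynomial.aeval ζ P = 0 := by
    simp only [hP, ha, ht, h]
    rw [mul_pow, hsq, sub_self]
  have hPu : Polynomial.aeval (ζ ^ u) P = 0 := by
    have hdvd := minpoly.isIntegrallyClosed_dvd (hζ.isIntegral hq) hP0
    rw [hζ.minpoly_eq_pow_coprime hu] at hdvd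
    obtain ⟨Q, hQ⟩ := hdvd
    rw [hQ, map_mul, minpoly.aeval, zero_mul]
  have hsum : ∑ i ∈ s, (ζ ^ u) ^ a i = ∑ i ∈ s, w i ^ u := by
    refine Finset.sum_congr rfl fun i _ => ?_
    rw [← ha, pow_right_comm]
  rw [hP, hsum, pow_right_comm ζ u t, ht, sub_eq_zero] at hPu
  have hnorm := congrArg norm hPu
  have hξ1 : ‖ξ‖ = 1 := Complex.norm_eq_one_of_pow_eq_one hξ hq.ne'
  rw [norm_pow, norm_mul, norm_pow, norm_pow, hξ1, Complex.norm_natCast] at hnorm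
  rw [← Real.sqrt_sq (norm_nonneg (∑ i ∈ s, w i ^ u)), hnorm]
  simp

theorem sum_pow_range_eq_zero_of_pow_eq_one {K : Type*} [Field K] {w : K} {m : ℕ}
    (hw : w ^ m = 1) (h1 : w ≠ 1) : ∑ i ∈ Finset.range m, w ^ i = 0 := by
  rw [geom_sum_eq h1, hw, sub_self, zero_div]

/-- The powers of `w` with exponent prime to `p`, as a difference of two geometric sums. -/
theorem sum_pow_filter_coprime_prime_pow {R : Type*} [CommRing R] {p k : ℕ} (hp : p.Prime)
    (hk : 0 < k) (w : R) :
    ∑ m ∈ Finset.range (p ^ k) with m.Coprime (p ^ k), w ^ m =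
      ∑ m ∈ Finset.range (p ^ k), w ^ m - ∑ m ∈ Finset.range (p ^ (k - 1)), (w ^ p) ^ m := by
  have hpk : p ^ k = p * p ^ (k - 1) := by rw [← pow_succ', Nat.sub_add_cancel hk]
  rw [eq_sub_iff_add_eq, ← Finset.sum_filter_add_sum_filter_not (Finset.range (p ^ k))
    (fun m => m.Coprime (p ^ k)) (fun m => w ^ m)]
  congr 1
  refine Finset.sum_bij (fun m _ => p * m) (fun m hm => ?_) (fun a _ b _ h => ?_)
    (fun m hm => ?_) (fun m _ => (pow_mul w p m).symm)
  · rw [Finset.mem_range] at hm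
    rw [Finset.mem_filter, Finset.mem_range, Nat.coprime_pow_right_iff hk, Nat.coprime_comm,
      hp.coprime_iff_not_dvd, not_not]
    exact ⟨hpk ▸ Nat.mul_lt_mul_of_pos_left hm hp.pos, dvd_mul_right p m⟩
  · exact Nat.eq_of_mul_eq_mul_left hp.pos h
  · rw [Finset.mem_filter, Finset.mem_range, Nat.coprime_pow_right_iff hk, Nat.coprime_comm,
      hp.coprime_iff_not_dvd, not_not] at hm
    obtain ⟨hlt, b, rfl⟩ := hm
    exact ⟨b, Finset.mem_range.2 (Nat.lt_of_mul_lt_mul_left (hpk ▸ hlt)), rfl⟩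

theorem zetaPow_eq_stdAddChar (q : ℕ) [NeZero q] (x : ZMod q) :
    zetaPow q x = ZMod.stdAddChar x := by
  rw [ZMod.stdAddChar_apply, ZMod.toCircle_apply, zetaPow]

theorem stdAddChar_pow_eq_one_iff (q : ℕ) [NeZero q] (x : ZMod q) (m : ℕ) :
    ZMod.stdAddChar x ^ m = (1 : ℂ) ↔ (m : ZMod q) * x = 0 := by
  rw [← AddChar.map_nsmul_eq_pow, ← nsmul_eq_mul, ← AddChar.map_zero_eq_one (ZMod.stdAddChar (N := q))]
  exact ZMod.injective_stdAddChar.eq_iff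

theorem mem_range_prime_pow_mul_iff {p k : ℕ} (hp : p.Prime) (hk : 0 < k)
    (x : ZMod (p ^ k)) :
    x ∈ Set.range (fun y : ZMod (p ^ k) => (p : ZMod (p ^ k)) ^ (k - 1) * y) ↔
      (p : ZMod (p ^ k)) * x = 0 := by
  have : NeZero (p ^ k) := ⟨pow_ne_zero k hp.ne_zero⟩
  have hpk : p ^ k = p * p ^ (k - 1) := by rw [← pow_succ', Nat.sub_add_cancel hk]
  constructor
  · rintro ⟨y, rfl⟩
    have h0 : (p : ZMod (p ^ k)) * (p : ZMod (p ^ k)) ^ (k - 1) = 0 := by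
      exact_mod_cast (ZMod.natCast_eq_zero_iff _ _).2 hpk.dvd
    simp only [← mul_assoc, h0, zero_mul]
  · intro h
    rw [← ZMod.natCast_zmod_val x, ← Nat.cast_mul, ZMod.natCast_eq_zero_iff] at h
    have h' : p * p ^ (k - 1) ∣ p * x.val := by rwa [← hpk]
    obtain ⟨b, hb⟩ := Nat.dvd_of_mul_dvd_mul_left hp.pos h'
    refine ⟨b, ?_⟩
    rw [← ZMod.natCast_zmod_val x, hb]
    push_cast
    rfl

/-- The homogeneous weight as an affine function of a Ramanujan sum. -/
theorem homWeight_eq_sub_sum {p k : ℕ} (hp : p.Prime) (hk : 2 ≤ k) [NeZero (p ^ k)]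
    (x : ZMod (p ^ k)) :
    (homWeight p k x : ℂ) = ((p : ℂ) - 1) * (p : ℂ) ^ (k - 2) -
      (∑ m ∈ Finset.range (p ^ k) with m.Coprime (p ^ k), ZMod.stdAddChar x ^ m) / p := by
  obtain ⟨j, rfl⟩ := Nat.exists_eq_add_of_le' hk
  have hp0 : (p : ℂ) ≠ 0 := Nat.cast_ne_zero.2 hp.ne_zero
  rw [sum_pow_filter_coprime_prime_pow hp (by omega), homWeight]
  simp only [mem_range_prime_pow_mul_iff hp (show 0 < j + 2 by omega) x]
  simp only [show j + 2 - 1 = j + 1 by omega, Nat.add_sub_cancel]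
  have hw1 := stdAddChar_pow_eq_one_iff (p ^ (j + 2)) x 1
  have hwp := stdAddChar_pow_eq_one_iff (p ^ (j + 2)) x p
  have hwq := (stdAddChar_pow_eq_one_iff (p ^ (j + 2)) x (p ^ (j + 2))).2 (by simp)
  rw [pow_one, Nat.cast_one, one_mul] at hw1
  set w : ℂ := ZMod.stdAddChar x
  by_cases hx : x = 0
  · simp only [hx, if_true, hw1.2 hx, one_pow, Finset.sum_const, Finset.card_range]
    field_simp
    push_cast
    simp
    ring
  rw [if_neg hx, sum_pow_range_eq_zero_of_pow_eq_one hwq (fun h => hx (hw1.1 h))]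
  by_cases hpx : (p : ZMod (p ^ (j + 2))) * x = 0
  · simp only [hpx, if_true, hwp.2 hpx, one_pow, Finset.sum_const, Finset.card_range]
    field_simp
    push_cast
    simp
    ring
  · rw [if_neg hpx, sum_pow_range_eq_zero_of_pow_eq_one
      (by rw [← pow_mul, ← pow_succ', hwq]) (fun h => hpx (hwp.1 h))]
    simp

/-- A vector whose character sum is `√n` times a root of unity has large homogeneous weight. -/
theorem le_sum_homWeight_of_sum_stdAddChar {p k n : ℕ} (hp : p.Prime) (hk : 2 ≤ k)
    [NeZero (p ^ k)] (v : Fin n → ZMod (p ^ k)) (ξ : ℂ) (hξ : ξ ^ (p ^ k) = 1)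
    (h : ∑ i, ZMod.stdAddChar (v i) = Real.sqrt n * ξ) :
    ((p : ℝ) ^ (k - 1) - (p : ℝ) ^ (k - 2)) * (n - Real.sqrt n) ≤
      ∑ i, homWeight p k (v i) := by
  have hp0 : (0 : ℝ) < p := Nat.cast_pos.2 hp.pos
  set T : ℂ := ∑ m ∈ Finset.range (p ^ k) with m.Coprime (p ^ k),
    ∑ i, ZMod.stdAddChar (v i) ^ m
  have hsum : ((∑ i, homWeight p k (v i) : ℝ) : ℂ) =
      ((n * (((p : ℝ) - 1) * (p : ℝ) ^ (k - 2)) : ℝ) : ℂ) - T / (p : ℝ) := by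
    push_cast
    simp only [homWeight_eq_sub_sum hp hk, Finset.sum_sub_distrib, T]
    rw [Finset.sum_comm, Finset.sum_div]
    simp
  have hre := congrArg Complex.re hsum
  rw [Complex.sub_re, Complex.ofReal_re, Complex.ofReal_re, Complex.div_ofReal_re] at hre
  have hcard : ((Finset.range (p ^ k)).filter (fun m => m.Coprime (p ^ k))).card =
      p ^ (k - 1) * (p - 1) := by
    rw [← Nat.totient_prime_pow hp (by omega), Nat.totient]
    simp only [Nat.coprime_comm]
  have hT : T.re ≤ (p : ℝ) ^ (k - 1) * (p - 1) * Real.sqrt n := by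
    refine (Complex.re_le_norm T).trans ((norm_sum_le_of_le (n := fun _ => Real.sqrt n) _
      fun m hm => ?_).trans_eq ?_)
    · refine (norm_sum_pow_eq_sqrt_of_coprime (Nat.pos_of_neZero (p ^ k))
        (Finset.mem_filter.1 hm).2 Finset.univ _ (fun i => ?_) ξ hξ h).le
      rw [stdAddChar_pow_eq_one_iff]
      simp
    · rw [Finset.sum_const, hcard, nsmul_eq_mul]
      push_cast [hp.one_le]
      rfl
  have hdiv : T.re / p ≤ (p : ℝ) ^ (k - 2) * (p - 1) * Real.sqrt n := by
    rw [div_le_iff₀ hp0]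
    refine hT.trans_eq ?_
    rw [show k - 1 = k - 2 + 1 by omega]
    ring
  rw [hre, show k - 1 = k - 2 + 1 by omega, pow_succ]
  linarith

/-- let `q = p^k` (`p` prime, `k ≥ 2`) and `H ∈ BH(n,q)`.  If `𝐱`
(entries `q`-th roots of unity, logarithmic form `Lx`) is a bent vector for `H` with
root-of-unity dual, then the covering radius of `C_H` for the homogeneous distance
satisfies `r(C_H) ≥ (p^{k-1} − p^{k-2})(n − √n)`. -/
theorem covRad_BHCode_lower_bound_prime_power (p k n : ℕ) (hp : p.Prime) (hk : 2 ≤ k)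
    (hn : 0 < n)
    (H : Matrix (Fin n) (Fin n) ℂ)
    (LH : Fin n → Fin n → ZMod (p ^ k))
    (hLH : ∀ i j, H i j = zetaPow (p ^ k) (LH i j))
    (hHad : H * H.conjTranspose = (n : ℂ) • 1)
    (x : Fin n → ℂ) (Lx : Fin n → ZMod (p ^ k))
    (hLx : ∀ i, x i = zetaPow (p ^ k) (Lx i))
    (hbent : ∀ i : Fin n, ∃ ζ : ℂ, ζ ^ (p ^ k) = 1 ∧
      ∑ j, x j * (starRingEnd ℂ) (H i j) = Real.sqrt n * ζ) :
    ((p : ℝ) ^ (k - 1) - (p : ℝ) ^ (k - 2)) * (n - Real.sqrt n) ≤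
      covRad p k n (BHCode (p ^ k) n LH) := by
  have : NeZero (p ^ k) := ⟨pow_ne_zero k hp.ne_zero⟩
  have : Nonempty (BHCode (p ^ k) n LH) := ⟨⟨_, ⟨0, hn⟩, 0, rfl⟩⟩
  refine le_trans (le_ciInf ?_) (le_ciSup (f := fun y => ⨅ c : BHCode (p ^ k) n LH,
    homDist p k n y c) (Set.finite_range _).bddAbove Lx)
  rintro ⟨_, i, α, rfl⟩
  obtain ⟨ξ, hξ, hsum⟩ := hbent i
  refine le_sum_homWeight_of_sum_stdAddChar hp hk _ (ξ * ZMod.stdAddChar (-α)) ?_ ?_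
  · rw [mul_pow, hξ, one_mul, stdAddChar_pow_eq_one_iff]
    simp
  · rw [← mul_assoc, ← hsum, Finset.sum_mul]
    refine Finset.sum_congr rfl fun j _ => ?_
    rw [hLx, hLH, zetaPow_eq_stdAddChar, zetaPow_eq_stdAddChar, ← AddChar.map_neg_eq_conj,
      ← AddChar.map_add_eq_mul, ← AddChar.map_add_eq_mul]
    congr 1
    ring
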